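/- For every k ∈ ℕ, ∫₀^∞ (∫_x^∞ h_{2k+1}(t) dt) · h_{2k}(x) dx = 1/(√2 · √(2k+1)). -/

import Mathlib

open MeasureTheory Real

/-- The normalized Hermite function of degree `k`:
`h_k(t) = (−1)^k (2^k k! √π)^{−1/2} e^{t²/2} (d/dt)^k(e^{−t²})`. -/
noncomputable def hermiteFun (k : ℕ) (t : ℝ) : ℝ :=
  (-1 : ℝ) ^ k * ((2 : ℝ) ^ k * (Nat.factorial k : ℝ) * Real.sqrt π) ^ (-(1 : ℝ) / 2) *
    Real.exp (t ^ 2 / 2) * iteratedDeriv k (fun s : ℝ => Real.exp (-s ^ 2)) t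

open Polynomial in
/-- The physicists' Hermite polynomials. -/
noncomputable def physHermite : ℕ → ℝ[X]
  | 0 => 1
  | n + 1 => 2 * X * physHermite n - derivative (physHermite n)

open Polynomial in
theorem derivative_physHermite_succ (n : ℕ) :
    derivative (physHermite (n + 1)) = 2 * ((n : ℝ[X]) + 1) * physHermite n := by
  induction n with
  | zero => simp [physHermite]
  | succ n ih =>
    rw [physHermite, derivative_sub, derivative_mul, ih]
    simp only [derivative_mul, derivative_add, derivative_natCast, derivative_one,
      derivative_X, derivative_ofNat, physHermite]
    push_cast
    ring

theorem physHermite_eval_zero_of_odd {n : ℕ} (hn : Odd n) : (physHermite n).eval 0 = 0 := by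
  obtain ⟨k, rfl⟩ := hn
  induction k with
  | zero => simp [physHermite]
  | succ k ih =>
    have h : 2 * (k + 1) + 1 = 2 * k + 1 + 1 + 1 := by ring
    rw [h, physHermite, derivative_physHermite_succ]
    simp [ih]

open Polynomial in
theorem hasDerivAt_eval_mul_exp_neg_mul_sq (p : ℝ[X]) (b x : ℝ) :
    HasDerivAt (fun y : ℝ => p.eval y * exp (-b * y ^ 2))
      ((derivative p - C (2 * b) * X * p).eval x * exp (-b * x ^ 2)) x := by
  have h := (p.hasDerivAt x).mul (((hasDerivAt_pow 2 x).const_mul (-b)).exp)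
  refine h.congr_deriv ?_
  simp
  ring

open Polynomial in
theorem integrable_eval_mul_exp_neg_mul_sq (p : ℝ[X]) {b : ℝ} (hb : 0 < b) :
    Integrable fun x : ℝ => p.eval x * exp (-b * x ^ 2) := by
  induction p using Polynomial.induction_on' with
  | add p q hp hq =>
    simp only [eval_add, add_mul]
    exact hp.add hq
  | monomial n a =>
    have hn : (-1 : ℝ) < n := neg_one_lt_zero.trans_le n.cast_nonneg
    simpa [mul_assoc] using (integrable_rpow_mul_exp_neg_mul_sq hb hn).const_mul a

open Polynomial in
theorem integral_Ioi_derivative_sub_mul_exp_neg_mul_sq (p : ℝ[X]) {b : ℝ} (hb : 0 < b) (a : ℝ) :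
    ∫ x in Set.Ioi a, (derivative p - C (2 * b) * X * p).eval x * exp (-b * x ^ 2) =
      -(p.eval a * exp (-b * a ^ 2)) := by
  have hint := (integrable_eval_mul_exp_neg_mul_sq
    (derivative p - C (2 * b) * X * p) hb).integrableOn (s := Set.Ioi a)
  have hlim := tendsto_zero_of_hasDerivAt_of_integrableOn_Ioi
    (fun x _ => hasDerivAt_eval_mul_exp_neg_mul_sq p b x) hint
    (integrable_eval_mul_exp_neg_mul_sq p hb).integrableOn
  rw [integral_Ioi_of_hasDerivAt_of_tendsto'
    (fun x _ => hasDerivAt_eval_mul_exp_neg_mul_sq p b x) hint hlim, zero_sub]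

theorem iteratedDeriv_exp_neg_sq (n : ℕ) :
    iteratedDeriv n (fun s : ℝ => exp (-s ^ 2)) =
      fun x => (-1) ^ n * ((physHermite n).eval x * exp (-1 * x ^ 2)) := by
  induction n with
  | zero => simp [physHermite]
  | succ n ih =>
    rw [iteratedDeriv_succ, ih]
    ext x
    rw [((hasDerivAt_eval_mul_exp_neg_mul_sq (physHermite n) 1 x).const_mul _).deriv]
    simp [physHermite]
    ring

theorem hermiteFun_eq_eval_physHermite (n : ℕ) (x : ℝ) :
    hermiteFun n x = ((2 : ℝ) ^ n * (n.factorial : ℝ) * √π) ^ (-(1 : ℝ) / 2) *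
      ((physHermite n).eval x * exp (-(1 / 2) * x ^ 2)) := by
  have he : exp (-(1 / 2) * x ^ 2) = exp (x ^ 2 / 2) * exp (-1 * x ^ 2) := by
    rw [← exp_add]; ring_nf
  have hs : (-1 : ℝ) ^ n * (-1) ^ n = 1 := by rw [← mul_pow]; simp
  rw [hermiteFun, iteratedDeriv_exp_neg_sq, he]
  linear_combination (((2 : ℝ) ^ n * (n.factorial : ℝ) * √π) ^ (-(1 : ℝ) / 2) *
    ((physHermite n).eval x * (exp (x ^ 2 / 2) * exp (-1 * x ^ 2)))) * hs

/-- Half-line integral of a polynomial against the weight `exp (-x ^ 2)`. -/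
noncomputable def halfGaussianIntegral (p : Polynomial ℝ) : ℝ :=
  ∫ x in Set.Ioi (0 : ℝ), p.eval x * exp (-1 * x ^ 2)

open Polynomial in
theorem halfGaussianIntegral_add (p q : ℝ[X]) :
    halfGaussianIntegral (p + q) = halfGaussianIntegral p + halfGaussianIntegral q := by
  simp only [halfGaussianIntegral, eval_add, add_mul]
  exact integral_add (integrable_eval_mul_exp_neg_mul_sq p one_pos).integrableOn
    (integrable_eval_mul_exp_neg_mul_sq q one_pos).integrableOn

open Polynomial in
theorem halfGaussianIntegral_C_mul (c : ℝ) (p : ℝ[X]) :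
    halfGaussianIntegral (C c * p) = c * halfGaussianIntegral p := by
  simp only [halfGaussianIntegral, eval_mul, eval_C, mul_assoc]
  exact integral_const_mul c _

open Polynomial in
theorem halfGaussianIntegral_mul_physHermite_succ (p : ℝ[X]) (n : ℕ) :
    halfGaussianIntegral (p * physHermite (n + 1)) =
      halfGaussianIntegral (derivative p * physHermite n) +
        p.eval 0 * (physHermite n).eval 0 := by
  have h := integral_Ioi_derivative_sub_mul_exp_neg_mul_sq (p * physHermite n) one_pos 0
  have hp : derivative p * physHermite n = p * physHermite (n + 1) +
      (derivative (p * physHermite n) - C (2 * 1) * X * (p * physHermite n)) := by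
    rw [physHermite, derivative_mul, mul_one, C_ofNat]
    ring
  rw [hp, halfGaussianIntegral_add, halfGaussianIntegral.eq_1 (_ - _), h]
  simp

theorem halfGaussianIntegral_physHermite_succ_mul_succ {m n : ℕ} (h : Odd (m + 1 + n)) :
    halfGaussianIntegral (physHermite (m + 1) * physHermite (n + 1)) =
      2 * (m + 1) * halfGaussianIntegral (physHermite m * physHermite n) := by
  have hz : (physHermite (m + 1)).eval 0 * (physHermite n).eval 0 = 0 := by
    rcases Nat.even_or_odd n with hn | hn
    · rw [physHermite_eval_zero_of_odd ((Nat.odd_add.1 h).2 hn), zero_mul]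
    · rw [physHermite_eval_zero_of_odd hn, mul_zero]
  rw [halfGaussianIntegral_mul_physHermite_succ, hz, add_zero, derivative_physHermite_succ,
    ← halfGaussianIntegral_C_mul]
  simp [mul_assoc, Polynomial.C_ofNat]

theorem halfGaussianIntegral_physHermite_sq (n : ℕ) :
    halfGaussianIntegral (physHermite n * physHermite n) = 2 ^ n * n.factorial * (√π / 2) := by
  induction n with
  | zero => simpa [halfGaussianIntegral, physHermite] using integral_gaussian_Ioi 1
  | succ n ih =>
    rw [halfGaussianIntegral_physHermite_succ_mul_succ ⟨n, by ring⟩, ih, Nat.factorial_succ]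
    push_cast
    ring

theorem halfGaussianIntegral_physHermite_mul_of_lt {m n : ℕ} (hmn : m < n) (h : Even (m + n)) :
    halfGaussianIntegral (physHermite m * physHermite n) = 0 := by
  induction m generalizing n with
  | zero =>
    obtain ⟨n, rfl⟩ := Nat.exists_eq_succ_of_ne_zero hmn.ne'
    have hn : Odd n := by grind
    rw [Nat.succ_eq_add_one, halfGaussianIntegral_mul_physHermite_succ,
      physHermite_eval_zero_of_odd hn]
    simp [physHermite, halfGaussianIntegral]
  | succ m ih =>
    obtain ⟨n, rfl⟩ := Nat.exists_eq_succ_of_ne_zero (Nat.ne_zero_of_lt hmn)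
    rw [Nat.succ_eq_add_one, halfGaussianIntegral_physHermite_succ_mul_succ (by grind),
      ih (by omega) (by grind), mul_zero]

open Polynomial in
/-- The polynomial factor of the tail integral of an odd-degree Hermite function. -/
noncomputable def hermiteTail : ℕ → ℝ[X]
  | 0 => C 2
  | k + 1 => C 2 * physHermite (2 * (k + 1)) + C (4 * ((k : ℝ) + 1)) * hermiteTail k

open Polynomial in
theorem derivative_hermiteTail_sub (k : ℕ) :
    derivative (hermiteTail k) - X * hermiteTail k = -physHermite (2 * k + 1) := by
  induction k with
  | zero =>
    simp only [hermiteTail, physHermite, C_ofNat, derivative_ofNat, derivative_one]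
    ring
  | succ k ih =>
    have hd : derivative (physHermite (2 * (k + 1))) =
        C (4 * ((k : ℝ) + 1)) * physHermite (2 * k + 1) := by
      rw [show 2 * (k + 1) = 2 * k + 1 + 1 by ring, derivative_physHermite_succ]
      simp only [map_mul, map_add, map_natCast, map_one, C_ofNat]
      push_cast
      ring
    rw [hermiteTail, physHermite, derivative_add, derivative_C_mul, derivative_C_mul, hd]
    have h2 : (C 2 : ℝ[X]) = 2 := C_ofNat 2
    rw [h2]
    linear_combination C (4 * ((k : ℝ) + 1)) * ih

theorem integral_Ioi_physHermite_odd (k : ℕ) (x : ℝ) :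
    ∫ t in Set.Ioi x, (physHermite (2 * k + 1)).eval t * exp (-(1 / 2) * t ^ 2) =
      (hermiteTail k).eval x * exp (-(1 / 2) * x ^ 2) := by
  have h := integral_Ioi_derivative_sub_mul_exp_neg_mul_sq (hermiteTail k)
    (one_half_pos (α := ℝ)) x
  rw [mul_one_div_cancel two_ne_zero, Polynomial.C_1, one_mul, derivative_hermiteTail_sub] at h
  simpa [integral_neg] using h

theorem halfGaussianIntegral_hermiteTail_mul_of_lt {k m : ℕ} (h : k < m) :
    halfGaussianIntegral (hermiteTail k * physHermite (2 * m)) = 0 := by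
  induction k with
  | zero =>
    have h0 := halfGaussianIntegral_physHermite_mul_of_lt
      (m := 0) (n := 2 * m) (by omega) (by grind)
    rw [physHermite, one_mul] at h0
    rw [hermiteTail, halfGaussianIntegral_C_mul, h0, mul_zero]
  | succ k ih =>
    rw [hermiteTail, add_mul, mul_assoc, mul_assoc, halfGaussianIntegral_add,
      halfGaussianIntegral_C_mul, halfGaussianIntegral_C_mul, ih (by omega),
      halfGaussianIntegral_physHermite_mul_of_lt (by omega) (by grind)]
    simp

theorem halfGaussianIntegral_hermiteTail_mul_self (k : ℕ) :
    halfGaussianIntegral (hermiteTail k * physHermite (2 * k)) =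
      2 ^ (2 * k) * (2 * k).factorial * √π := by
  cases k with
  | zero =>
    have h0 := halfGaussianIntegral_physHermite_sq 0
    rw [physHermite, one_mul] at h0
    rw [hermiteTail, halfGaussianIntegral_C_mul, mul_zero, physHermite, h0]
    simp
    ring
  | succ k =>
    rw [hermiteTail, add_mul, mul_assoc, mul_assoc, halfGaussianIntegral_add,
      halfGaussianIntegral_C_mul, halfGaussianIntegral_C_mul,
      halfGaussianIntegral_hermiteTail_mul_of_lt (Nat.lt_succ_self k),
      halfGaussianIntegral_physHermite_sq]
    ring

theorem cross_term_integral (k : ℕ) :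
    (∫ x in Set.Ioi (0 : ℝ),
        (∫ t in Set.Ioi x, hermiteFun (2 * k + 1) t) * hermiteFun (2 * k) x)
      = 1 / (Real.sqrt 2 * Real.sqrt (2 * (k : ℝ) + 1)) := by
  set A : ℝ := 2 ^ (2 * k) * (2 * k).factorial * √π with hA
  have hApos : 0 < A := by positivity
  have hB : (2 : ℝ) ^ (2 * k + 1) * (2 * k + 1).factorial * √π = 2 * (2 * k + 1) * A := by
    rw [hA, Nat.factorial_succ]
    push_cast
    ring
  have hpow {y : ℝ} (hy : 0 ≤ y) : y ^ (-(1 : ℝ) / 2) = (√y)⁻¹ := by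
    rw [neg_div, rpow_neg hy, sqrt_eq_rpow]
  have hfun (x : ℝ) :
      (∫ t in Set.Ioi x, hermiteFun (2 * k + 1) t) * hermiteFun (2 * k) x =
        (√(2 * (2 * k + 1) * A))⁻¹ * (√A)⁻¹ *
          ((hermiteTail k * physHermite (2 * k)).eval x * exp (-1 * x ^ 2)) := by
    have he : exp (-1 * x ^ 2) = exp (-(1 / 2) * x ^ 2) * exp (-(1 / 2) * x ^ 2) := by
      rw [← exp_add]; ring_nf
    simp only [hermiteFun_eq_eval_physHermite, hB, ← hA]
    rw [integral_const_mul, integral_Ioi_physHermite_odd, hpow (by positivity), hpow hApos.le,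
      he, Polynomial.eval_mul]
    ring
  simp only [hfun]
  have hI := halfGaussianIntegral_hermiteTail_mul_self k
  rw [← hA, halfGaussianIntegral] at hI
  rw [integral_const_mul, hI, sqrt_mul (by positivity), sqrt_mul (by positivity)]
  have hsA : √A ≠ 0 := (sqrt_pos.2 hApos).ne'
  have hsq : √A ^ 2 = A := sq_sqrt hApos.le
  field_simp
  exact hsq.symm
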